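/- arXiv:0907.5137 — 2 statements merged into one kernel-verified Lean document; each statement's English description precedes it below -/
import Mathlib

section
/- Suppose there are constants α₁ > α₂ > 0 and c₁ > 0 and, for each n, a set B_n ⊆ {0,1}^n × {0,1}^n such that every (x,y) ∈ B_n satisfies n₊(x,y) ≥ α₁·N₁(x,y) and n₋(x,y) ≤ α₂·N₁(x,y), and such that P((X,Y) ∈ B_n) ≥ 1 − e^{−c₁ n} for all n. Set α₃ = (α₁ − α₂)/2 and I = [2εn − √(2ε(1−ε)n), 2εn + √(2ε(1−ε)n)]. Then there exists a constant c₄ > 0 such that, for all sufficiently large n, with probability at least 1 − e^{−c₄·n^{0.1}} the following event holds: for all integers i, j ∈ I with i + n^{0.1} ≤ j, one has L(i) − L(j) ≥ α₃·(j − i). -/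
open scoped BigOperators
open Classical

noncomputable section

/-- Length of a longest common subsequence of two boolean lists. -/
def lcsLen (x y : List Bool) : ℕ :=
  sSup {k : ℕ | ∃ z : List Bool, z.length = k ∧ z.Sublist x ∧ z.Sublist y}

/-- Bernoulli(ε) product weight of a binary string. -/
def wt (ε : ℝ) {n : ℕ} (x : Fin n → Bool) : ℝ :=
  ∏ i, if x i then ε else 1 - ε

/-- Probability of an event about two independent i.i.d. Bernoulli(ε) strings of length n. -/
def pr (ε : ℝ) (n : ℕ) (E : (Fin n → Bool) → (Fin n → Bool) → Prop) : ℝ :=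
  ∑ x : Fin n → Bool, ∑ y : Fin n → Bool, if E x y then wt ε x * wt ε y else 0

/-- LCS length of two binary strings of length n. -/
def Lcs {n : ℕ} (x y : Fin n → Bool) : ℕ := lcsLen (List.ofFn x) (List.ofFn y)

/-- Number of ones in a binary string. -/
def numOnes {n : ℕ} (x : Fin n → Bool) : ℕ :=
  (Finset.univ.filter fun i => x i = true).card

/-- Total number of ones in the pair (x, y). -/
def N1 {n : ℕ} (x y : Fin n → Bool) : ℕ := numOnes x + numOnes y

/-- Change the entry at position i into a zero. -/
def flipToZero {n : ℕ} (x : Fin n → Bool) (i : Fin n) : Fin n → Bool :=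
  Function.update x i false

/-- Number of ones (in either string) whose change into a zero increases the LCS length by 1. -/
def nPlus {n : ℕ} (x y : Fin n → Bool) : ℕ :=
  (Finset.univ.filter fun i => x i = true ∧ Lcs (flipToZero x i) y = Lcs x y + 1).card +
  (Finset.univ.filter fun i => y i = true ∧ Lcs x (flipToZero y i) = Lcs x y + 1).card

/-- Number of ones (in either string) whose change into a zero decreases the LCS length by 1. -/
def nMinus {n : ℕ} (x y : Fin n → Bool) : ℕ :=
  (Finset.univ.filter fun i => x i = true ∧ Lcs (flipToZero x i) y + 1 = Lcs x y).card +
  (Finset.univ.filter fun i => y i = true ∧ Lcs x (flipToZero y i) + 1 = Lcs x y).card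

/-- A state: a pair of binary strings of length n. -/
abbrev State (n : ℕ) := (Fin n → Bool) × (Fin n → Bool)

/-- Positions (in either string) carrying a one. -/
def onesSet {n : ℕ} (s : State n) : Finset (Fin n ⊕ Fin n) :=
  Finset.univ.filter fun p => Sum.elim s.1 s.2 p = true

/-- Change the entry at the given position into a zero. -/
def flipPos {n : ℕ} (s : State n) : Fin n ⊕ Fin n → State n
  | Sum.inl i => (Function.update s.1 i false, s.2)
  | Sum.inr i => (s.1, Function.update s.2 i false)

/-- One-step transition probability of the chain: pick one of the ones uniformly at random and
change it into a zero (if there is no one, stay put). -/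
def stepMass {n : ℕ} (s t : State n) : ℝ :=
  if (onesSet s).card = 0 then (if t = s then 1 else 0)
  else ((onesSet s).filter fun p => flipPos s p = t).card / (onesSet s).card

/-- Probability of a trajectory (path j = state after j one-to-zero flips, started from the
all-ones pair of strings). -/
def trajMass (n : ℕ) (path : Fin (2 * n + 1) → State n) : ℝ :=
  (if path 0 = ((fun _ => true), (fun _ => true)) then (1 : ℝ) else 0) *
    ∏ j : Fin (2 * n), stepMass (path j.castSucc) (path j.succ)

/-- Probability of an event about the whole trajectory of the chain. -/
def trajProb (n : ℕ) (E : (Fin (2 * n + 1) → State n) → Prop) : ℝ :=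
  ∑ path : Fin (2 * n + 1) → State n, if E path then trajMass n path else 0

/-- LCS length of a state. -/
def Lof {n : ℕ} (s : State n) : ℕ := Lcs s.1 s.2

lemma pathSum_eq {S : Type} [Fintype S] (M : ℕ → S → S → ℝ) (f : S → ℝ) (F : ℕ → S → ℝ)
    (h0 : F 0 = f) (hF : ∀ k s', F (k+1) s' = ∑ s, F k s * M k s s') (m : ℕ) :
    ∀ g : S → ℝ, ∑ p : Fin (m+1) → S, f (p 0) * (∏ j : Fin m, M j (p j.castSucc) (p j.succ)) * g (p (Fin.last m))
      = ∑ s, F m s * g s := by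
  induction m with
  | zero =>
    intro g
    rw [← (Equiv.funUnique (Fin 1) S).symm.sum_comp]
    simp [h0]
  | succ m ih =>
    intro g
    rw [← (Fin.snocEquiv (fun _ : Fin (m+2) => S)).sum_comp, Fintype.sum_prod_type, Finset.sum_comm]
    have := ih (fun s => ∑ s', M m s s' * g s')
    have h2 : ∀ p : Fin (m+1) → S, ∀ s' : S,
        f ((Fin.snocEquiv (fun _ : Fin (m+2) => S)) (s', p) 0) * (∏ j : Fin (m+1), M j ((Fin.snocEquiv (fun _ : Fin (m+2) => S)) (s', p) j.castSucc) ((Fin.snocEquiv (fun _ : Fin (m+2) => S)) (s', p) j.succ)) * g ((Fin.snocEquiv (fun _ : Fin (m+2) => S)) (s', p) (Fin.last (m+1)))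
        = f (p 0) * (∏ j : Fin m, M j (p j.castSucc) (p j.succ)) * (M m (p (Fin.last m)) s' * g s') := by
      intro p s'
      rw [Fin.prod_univ_castSucc]
      simp only [Fin.snocEquiv_apply, Fin.snoc_castSucc, Fin.succ_last, Fin.snoc_last, Fin.succ_castSucc, Fin.val_castSucc, Fin.val_last]
      rw [show (0 : Fin (m+2)) = Fin.castSucc 0 from rfl, Fin.snoc_castSucc]
      ring
    simp_rw [h2, ← Finset.mul_sum]
    rw [this]
    simp_rw [hF, Finset.mul_sum, Finset.sum_mul]
    rw [Finset.sum_comm]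
    refine Finset.sum_congr rfl fun _ _ => Finset.sum_congr rfl fun _ _ => by ring

/-- forward iterates -/
def fwd {S : Type} [Fintype S] (M : ℕ → S → S → ℝ) (f : S → ℝ) : ℕ → S → ℝ
  | 0 => f
  | k+1 => fun s' => ∑ s, fwd M f k s * M k s s'

lemma pathSum_fwd {S : Type} [Fintype S] (M : ℕ → S → S → ℝ) (f : S → ℝ) (m : ℕ) :
    ∑ p : Fin (m+1) → S, f (p 0) * (∏ j : Fin m, M j (p j.castSucc) (p j.succ))
      = ∑ s, fwd M f m s := by
  have := pathSum_eq M f (fwd M f) rfl (fun _ _ => rfl) m (fun _ => 1)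
  simpa using this

lemma fwd_nonneg {S : Type} [Fintype S] (M : ℕ → S → S → ℝ) (f : S → ℝ) (hf : ∀ s, 0 ≤ f s)
    (hM : ∀ k s s', 0 ≤ M k s s') (m : ℕ) : ∀ s, 0 ≤ fwd M f m s := by
  induction m with
  | zero => exact hf
  | succ m ih => exact fun s' => Finset.sum_nonneg fun s _ => mul_nonneg (ih s) (hM _ _ _)

lemma fwd_sum_le {S : Type} [Fintype S] (M : ℕ → S → S → ℝ) (f : S → ℝ) (hf : ∀ s, 0 ≤ f s)
    (hM : ∀ k s s', 0 ≤ M k s s') (r : ℕ → ℝ) (hr0 : ∀ k, 0 ≤ r k) (hr : ∀ k s, ∑ s', M k s s' ≤ r k) (m : ℕ) :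
    ∑ s, fwd M f m s ≤ (∑ s, f s) * ∏ k ∈ Finset.range m, r k := by
  induction m with
  | zero => simp [fwd]
  | succ m ih =>
    rw [Finset.prod_range_succ, ← mul_assoc]
    calc ∑ s', fwd M f (m+1) s' = ∑ s, fwd M f m s * ∑ s', M m s s' := by
          simp only [fwd, Finset.mul_sum]; rw [Finset.sum_comm]
      _ ≤ ∑ s, fwd M f m s * r m := Finset.sum_le_sum fun s _ =>
          mul_le_mul_of_nonneg_left (hr _ _) (fwd_nonneg M f hf hM m s)
      _ ≤ _ := by rw [← Finset.sum_mul]; exact mul_le_mul_of_nonneg_right ih (hr0 m)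

lemma fwd_sum_succ {S : Type} [Fintype S] (M : ℕ → S → S → ℝ) (f : S → ℝ) (m : ℕ) 
    (h1 : ∀ s, ∑ s', M m s s' = 1) :
    ∑ s, fwd M f (m+1) s = ∑ s, fwd M f m s := by
  simp only [fwd]; rw [Finset.sum_comm]; simp_rw [← Finset.mul_sum, h1, mul_one]

lemma fwd_congr {S : Type} [Fintype S] (M M' : ℕ → S → S → ℝ) (f : S → ℝ) (m : ℕ) 
    (h : ∀ k < m, M k = M' k) : fwd M f m = fwd M' f m := by
  induction m with
  | zero => rfl
  | succ m ih =>
    have := ih (fun k hk => h k (by omega))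
    simp only [fwd, this, h m (by omega)]

/-- one-time marginal bound -/
lemma marginal {S : Type} [Fintype S] (K : S → S → ℝ) (f : S → ℝ) (hK : ∀ s, ∑ s', K s s' = 1)
    (A : S → Prop) (m t : ℕ) (ht : t < m) :
    ∑ p : Fin (m+1) → S, (if A (p ⟨t, by omega⟩) then f (p 0) * (∏ j : Fin m, K (p j.castSucc) (p j.succ)) else 0)
      = ∑ s, if A s then fwd (fun _ => K) f t s else 0 := by
  set M : ℕ → S → S → ℝ := fun k s s' => K s s' * (if k = t then (if A s then 1 else 0) else 1) with hM
  have h1 : ∀ p : Fin (m+1) → S, (if A (p ⟨t, by omega⟩) then f (p 0) * (∏ j : Fin m, K (p j.castSucc) (p j.succ)) else 0)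
      = f (p 0) * (∏ j : Fin m, M j (p j.castSucc) (p j.succ)) := by
    intro p
    simp only [hM, Finset.prod_mul_distrib]
    have : (∏ j : Fin m, (if (j : ℕ) = t then (if A (p j.castSucc) then (1:ℝ) else 0) else 1)) = if A (p ⟨t, by omega⟩) then 1 else 0 := by
      rw [Finset.prod_eq_single (⟨t, ht⟩ : Fin m)]
      · simp
      · intro b _ hb
        rw [if_neg]; intro h; exact hb (Fin.ext h)
      · simp
    rw [this]; split_ifs <;> simp
  simp_rw [h1]
  rw [pathSum_fwd]
  have h2 : ∑ s, fwd M f (t+1) s = ∑ s, if A s then fwd (fun _ => K) f t s else 0 := by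
    simp only [fwd]; rw [Finset.sum_comm]
    rw [fwd_congr M (fun _ => K) f t (fun k hk => by funext s s'; simp [hM, hk.ne])]
    refine Finset.sum_congr rfl fun s _ => ?_
    simp only [hM, if_true]
    split_ifs <;> simp [← Finset.mul_sum, hK]
  rw [← h2]
  obtain ⟨d, rfl⟩ : ∃ d, m = t + 1 + d := ⟨m - (t+1), by omega⟩
  clear h1 h2 ht
  induction d with
  | zero => rfl
  | succ d ih =>
    rw [← add_assoc, fwd_sum_succ, ih]
    intro s
    have : t + 1 + d ≠ t := by omega
    simp [hM, this, hK]

lemma stepMass_nonneg {n : ℕ} (s t : State n) : 0 ≤ stepMass s t := by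
  unfold stepMass; split_ifs <;> positivity

lemma stepMass_sum {n : ℕ} (s : State n) (h : State n → ℝ) (hs : (onesSet s).card ≠ 0) :
    ∑ t, stepMass s t * h t = (∑ p ∈ onesSet s, h (flipPos s p)) / (onesSet s).card := by
  have : ∀ t, stepMass s t * h t = (∑ p ∈ onesSet s, if flipPos s p = t then h t else 0) / (onesSet s).card := by
    intro t
    unfold stepMass
    rw [if_neg hs, ← Finset.sum_filter, Finset.sum_const, nsmul_eq_mul]; ring
  simp_rw [this]
  rw [← Finset.sum_div, Finset.sum_comm]
  congr 1
  refine Finset.sum_congr rfl fun p _ => ?_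
  simp

lemma stepMass_sum_one {n : ℕ} (s : State n) : ∑ t, stepMass s t = 1 := by
  by_cases hs : (onesSet s).card = 0
  · unfold stepMass; simp [hs]
  · have := stepMass_sum s (fun _ => 1) hs
    simp only [mul_one] at this
    rw [this, Finset.sum_const, nsmul_eq_mul, mul_one, div_self (by exact_mod_cast hs)]

def allOnes (n : ℕ) : State n := ((fun _ => true), (fun _ => true))

def startMass (n : ℕ) (s : State n) : ℝ := if s = allOnes n then 1 else 0

lemma startMass_sum (n : ℕ) : ∑ s, startMass n s = 1 := by simp [startMass]
lemma startMass_nonneg (n : ℕ) (s) : 0 ≤ startMass n s := by unfold startMass; split_ifs <;> norm_num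

lemma trajMass_eq (n : ℕ) (p) : trajMass n p = startMass n (p 0) * ∏ j : Fin (2 * n), stepMass (p j.castSucc) (p j.succ) := by
  unfold trajMass startMass allOnes
  congr

lemma trajMass_nonneg (n : ℕ) (p) : 0 ≤ trajMass n p := by
  rw [trajMass_eq]; exact mul_nonneg (startMass_nonneg _ _) (Finset.prod_nonneg fun _ _ => stepMass_nonneg _ _)

lemma trajMass_sum (n : ℕ) : ∑ p, trajMass n p = 1 := by
  simp_rw [trajMass_eq]
  rw [pathSum_fwd (fun _ => stepMass) (startMass n) (2*n)]
  have : ∀ m, ∑ s, fwd (fun _ => stepMass) (startMass n) m s = 1 := by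
    intro m
    induction m with
    | zero => exact startMass_sum n
    | succ m ih => rw [fwd_sum_succ _ _ _ (fun s => stepMass_sum_one s), ih]
  exact this _

lemma onesSet_flip {n : ℕ} (s : State n) (p : Fin n ⊕ Fin n) : onesSet (flipPos s p) = (onesSet s).erase p := by
  ext q
  rcases p with i | i <;> rcases q with j | j <;> simp [onesSet, flipPos, Function.update_apply]

lemma state_eq_of_onesSet {n : ℕ} {s t : State n} (h : onesSet s = onesSet t) : s = t := by
  have key : ∀ p, (Sum.elim s.1 s.2 p = true ↔ Sum.elim t.1 t.2 p = true) := by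
    intro p
    have := Finset.ext_iff.1 h p
    simpa [onesSet] using this
  refine Prod.ext (funext fun i => ?_) (funext fun i => ?_)
  · exact Bool.eq_iff_iff.2 (key (Sum.inl i))
  · exact Bool.eq_iff_iff.2 (key (Sum.inr i))

lemma onesSet_card_le {n : ℕ} (s : State n) : (onesSet s).card ≤ 2 * n := by
  refine (Finset.card_le_univ _).trans ?_
  simp; omega

lemma card_filter_sum {n : ℕ} (P : Fin n ⊕ Fin n → Prop) [DecidablePred P] :
    (Finset.univ.filter P).card = (Finset.univ.filter fun i => P (Sum.inl i)).card + (Finset.univ.filter fun i => P (Sum.inr i)).card := by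
  simp only [Finset.card_filter, Fintype.sum_sum_type]

lemma onesSet_card {n : ℕ} (s : State n) : (onesSet s).card = N1 s.1 s.2 := by
  unfold onesSet N1 numOnes
  rw [card_filter_sum]
  congr!

/-- Marginal of the chain is at most uniform on states with `2n - t` ones. -/
lemma fwd_uniform (n t : ℕ) (ht : t ≤ 2 * n) (s : State n) :
    fwd (fun _ => stepMass) (startMass n) t s ≤ if (onesSet s).card = 2 * n - t then 1 / ((2*n).choose t : ℝ) else 0 := by
  induction t generalizing s with
  | zero =>
    simp only [fwd, startMass]
    split_ifs with h1 h2 h2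
    · simp
    · exfalso; apply h2; subst h1
      simp [onesSet, allOnes]
      omega
    · simp
    · rfl
  | succ t ih =>
    simp only [fwd]
    set c : ℝ := 1 / ((2*n).choose t : ℝ) / ((2 * n - t : ℕ) : ℝ) with hc
    have hc0 : 0 ≤ c := by positivity
    have h1 : ∀ s' : State n, fwd (fun _ => stepMass) (startMass n) t s' * stepMass s' s ≤
        ∑ p : Fin n ⊕ Fin n, if onesSet s' = insert p (onesSet s) ∧ p ∉ onesSet s ∧ (onesSet s).card = 2*n-(t+1) then c else 0 := by
      intro s'
      have hR : 0 ≤ ∑ p : Fin n ⊕ Fin n, if onesSet s' = insert p (onesSet s) ∧ p ∉ onesSet s ∧ (onesSet s).card = 2*n-(t+1) then c else 0 :=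
        Finset.sum_nonneg fun p _ => by split_ifs <;> first | exact hc0 | exact le_rfl
      have hi := ih (by omega) s'
      have hn := stepMass_nonneg s' s
      refine (mul_le_mul_of_nonneg_right hi hn).trans ?_
      split_ifs with hcard
      · have h0 : (onesSet s').card ≠ 0 := by omega
        unfold stepMass
        rw [if_neg h0, Finset.card_filter, hcard]
        push_cast
        rw [Finset.sum_div, Finset.mul_sum]
        refine (Finset.sum_le_sum (g := fun p => if onesSet s' = insert p (onesSet s) ∧ p ∉ onesSet s ∧ (onesSet s).card = 2*n-(t+1) then c else 0) ?_).trans (Finset.sum_le_sum_of_subset_of_nonneg (Finset.subset_univ _) ?_)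
        · intro p hp
          by_cases hf : flipPos s' p = s
          · have h3 := onesSet_flip s' p
            rw [hf] at h3
            rw [if_pos hf, if_pos]
            · rw [hc]; apply le_of_eq; ring
            · refine ⟨?_, ?_, ?_⟩
              · rw [h3, Finset.insert_erase hp]
              · rw [h3]; simp
              · rw [h3, Finset.card_erase_of_mem hp, hcard]; omega
          · rw [if_neg hf]; simp only [zero_div, mul_zero]
            split_ifs <;> first | exact hc0 | exact le_rfl
        · intro p _ _
          split_ifs <;> first | exact hc0 | exact le_rfl
      · rw [zero_mul]; exact hR
    refine (Finset.sum_le_sum fun s' _ => h1 s').trans ?_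
    rw [Finset.sum_comm]
    have h2 : ∀ p : Fin n ⊕ Fin n, (∑ s' : State n, if onesSet s' = insert p (onesSet s) ∧ p ∉ onesSet s ∧ (onesSet s).card = 2*n-(t+1) then c else 0)
       ≤ if p ∉ onesSet s ∧ (onesSet s).card = 2*n-(t+1) then c else 0 := by
      intro p
      by_cases hp : p ∉ onesSet s ∧ (onesSet s).card = 2*n-(t+1)
      · simp only [hp, and_true, if_true, not_false_eq_true]
        rw [← Finset.sum_filter, Finset.sum_const, nsmul_eq_mul]
        have : (Finset.univ.filter fun s' : State n => onesSet s' = insert p (onesSet s)).card ≤ 1 := by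
          rw [Finset.card_le_one]
          intro a ha b hb
          simp only [Finset.mem_filter, Finset.mem_univ, true_and] at ha hb
          exact state_eq_of_onesSet (ha.trans hb.symm)
        have : ((Finset.univ.filter fun s' : State n => onesSet s' = insert p (onesSet s)).card : ℝ) ≤ 1 := by exact_mod_cast this
        nlinarith
      · rw [if_neg hp]
        apply le_of_eq
        apply Finset.sum_eq_zero
        intro s' _
        rw [if_neg]; tauto
    refine (Finset.sum_le_sum fun p _ => h2 p).trans ?_
    by_cases hcard : (onesSet s).card = 2*n-(t+1)
    · simp only [hcard, and_true, if_true]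
      rw [← Finset.sum_filter, Finset.sum_const, nsmul_eq_mul]
      have h4 : (Finset.univ.filter fun p => p ∉ onesSet s) = (onesSet s)ᶜ := by ext; simp
      rw [h4, Finset.card_compl, hcard]
      have h5 : Fintype.card (Fin n ⊕ Fin n) - (2*n - (t+1)) = t+1 := by simp; omega
      rw [h5, hc]
      have h6 := Nat.choose_succ_right_eq (2*n) t
      have h7 : ((2*n).choose (t+1) : ℝ) * ((t+1 : ℕ):ℝ) = ((2*n).choose t : ℝ) * ((2*n - t : ℕ) : ℝ) := by exact_mod_cast h6
      have h8 : (0:ℝ) < (2*n).choose (t+1) := by exact_mod_cast Nat.choose_pos ht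
      have h9 : (0:ℝ) < (2*n).choose t := by exact_mod_cast Nat.choose_pos (by omega)
      have h10 : (0:ℝ) < ((2*n - t : ℕ) : ℝ) := by exact_mod_cast (by omega)
      apply le_of_eq
      rw [div_div, ← h7]
      field_simp
    · simp [hcard]

/-! LCS -/
lemma lcs_set_bdd (x y : List Bool) : BddAbove {k : ℕ | ∃ z : List Bool, z.length = k ∧ z.Sublist x ∧ z.Sublist y} :=
  ⟨x.length, by rintro k ⟨z, rfl, h, _⟩; exact h.length_le⟩

lemma lcs_set_ne (x y : List Bool) : {k : ℕ | ∃ z : List Bool, z.length = k ∧ z.Sublist x ∧ z.Sublist y}.Nonempty :=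
  ⟨0, [], rfl, by simp, by simp⟩

lemma lcsLen_comm (x y : List Bool) : lcsLen x y = lcsLen y x := by
  unfold lcsLen; congr 1; ext k; constructor <;> rintro ⟨z, h1, h2, h3⟩ <;> exact ⟨z, h1, h3, h2⟩

lemma lcsLen_change (a c y : List Bool) (b b' : Bool) : lcsLen (a ++ b :: c) y ≤ lcsLen (a ++ b' :: c) y + 1 := by
  obtain ⟨z, hz, hx, hy⟩ := Nat.sSup_mem (lcs_set_ne (a ++ b :: c) y) (lcs_set_bdd _ _)
  change z.length = lcsLen _ _ at hz
  rw [← hz]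
  obtain ⟨z1, z2, rfl, h1, h2⟩ := List.sublist_append_iff.1 hx
  have h3 : z2.tail.Sublist c := by
    have := h2.tail; simpa using this
  have h4 : (z1 ++ z2.tail).length ≤ lcsLen (a ++ b' :: c) y := by
    apply le_csSup (lcs_set_bdd _ _)
    refine ⟨_, rfl, h1.append (h3.trans (List.sublist_cons_self _ _)), ?_⟩
    exact ((List.Sublist.refl z1).append (List.tail_sublist z2)).trans hy
  simp at h4 ⊢
  omega

lemma ofFn_update_decomp {n : ℕ} (x : Fin n → Bool) (i : Fin n) (b : Bool) :
    List.ofFn (Function.update x i b) = (List.ofFn x).take i ++ b :: (List.ofFn x).drop (i+1) := by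
  have : List.ofFn (Function.update x i b) = (List.ofFn x).set i b := by
    apply List.ext_getElem
    · simp
    · intro j h1 h2
      simp [List.getElem_set, Function.update_apply, Fin.ext_iff, eq_comm]
  rw [this, List.set_eq_take_append_cons_drop]
  simp

lemma Lcs_update_left {n : ℕ} (x y : Fin n → Bool) (i : Fin n) (b : Bool) :
    Lcs (Function.update x i b) y ≤ Lcs x y + 1 ∧ Lcs x y ≤ Lcs (Function.update x i b) y + 1 := by
  have h : List.ofFn x = (List.ofFn x).take i ++ (x i) :: (List.ofFn x).drop (i+1) := by
    have := ofFn_update_decomp x i (x i)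
    rwa [Function.update_eq_self] at this
  unfold Lcs
  rw [ofFn_update_decomp]
  constructor
  · conv_rhs => rw [h]
    exact lcsLen_change _ _ _ _ _
  · conv_lhs => rw [h]
    exact lcsLen_change _ _ _ _ _

lemma Lcs_comm {n : ℕ} (x y : Fin n → Bool) : Lcs x y = Lcs y x := lcsLen_comm _ _

lemma Lof_flip {n : ℕ} (s : State n) (p : Fin n ⊕ Fin n) :
    Lof (flipPos s p) ≤ Lof s + 1 ∧ Lof s ≤ Lof (flipPos s p) + 1 := by
  rcases p with i | i
  · exact Lcs_update_left _ _ _ _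
  · unfold Lof flipPos
    simp only
    rw [Lcs_comm, Lcs_comm s.1]
    exact Lcs_update_left _ _ _ _

lemma nPlus_eq {n : ℕ} (s : State n) : nPlus s.1 s.2 = ((onesSet s).filter fun p => Lof (flipPos s p) = Lof s + 1).card := by
  unfold onesSet nPlus
  rw [Finset.filter_filter, card_filter_sum]
  congr!

lemma nMinus_eq {n : ℕ} (s : State n) : nMinus s.1 s.2 = ((onesSet s).filter fun p => Lof (flipPos s p) + 1 = Lof s).card := by
  unfold onesSet nMinus
  rw [Finset.filter_filter, card_filter_sum]
  congr!

lemma step_exp {n : ℕ} (s : State n) (α₁ α₂ l : ℝ) (hl : 0 ≤ l) (hl1 : l ≤ 1) (hα₁ : 0 ≤ α₁) (hα₂ : 0 ≤ α₂)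
    (h1 : α₁ * (N1 s.1 s.2 : ℝ) ≤ (nPlus s.1 s.2 : ℝ)) (h2 : (nMinus s.1 s.2 : ℝ) ≤ α₂ * (N1 s.1 s.2 : ℝ))
    (hs : (onesSet s).card ≠ 0) :
    ∑ t, stepMass s t * Real.exp (-l * ((Lof t : ℝ) - Lof s)) ≤ Real.exp (-(α₁ - α₂) * l + (α₁ + α₂) * l^2) := by
  rw [stepMass_sum s _ hs]
  have hk : (0:ℝ) < (onesSet s).card := by exact_mod_cast Nat.pos_of_ne_zero hs
  rw [← onesSet_card, nPlus_eq] at h1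
  rw [← onesSet_card, nMinus_eq] at h2
  set k : ℝ := ((onesSet s).card : ℝ)
  have hp : ∀ p ∈ onesSet s, Real.exp (-l * ((Lof (flipPos s p) : ℝ) - Lof s)) =
      1 + (if Lof (flipPos s p) = Lof s + 1 then 1 else 0) * (Real.exp (-l) - 1)
        + (if Lof (flipPos s p) + 1 = Lof s then 1 else 0) * (Real.exp l - 1) := by
    intro p _
    obtain ⟨ha, hb⟩ := Lof_flip s p
    by_cases c1 : Lof (flipPos s p) = Lof s + 1
    · rw [if_pos c1, if_neg (by omega), c1]; push_cast; ring_nf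
    · by_cases c2 : Lof (flipPos s p) + 1 = Lof s
      · rw [if_neg c1, if_pos c2, ← c2]; push_cast; ring_nf
      · have : Lof (flipPos s p) = Lof s := by omega
        rw [if_neg c1, if_neg c2, this]; simp
  rw [Finset.sum_congr rfl hp, Finset.sum_add_distrib, Finset.sum_add_distrib, ← Finset.sum_mul, ← Finset.sum_mul]
  rw [Finset.card_filter] at h1 h2
  push_cast at h1 h2
  rw [Finset.sum_const, nsmul_eq_mul, mul_one]
  have e1 : Real.exp (-l) - 1 ≤ -l + l^2 := by
    have := Real.abs_exp_sub_one_sub_id_le (x := -l) (by rw [abs_neg, abs_of_nonneg hl]; exact hl1)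
    have := (abs_le.1 this).2; nlinarith
  have e1' : Real.exp (-l) - 1 ≤ 0 := by
    have := Real.exp_le_one_iff.2 (neg_nonpos.2 hl); linarith
  have e2 : Real.exp l - 1 ≤ l + l^2 := by
    have := Real.abs_exp_sub_one_sub_id_le (x := l) (by rw [abs_of_nonneg hl]; exact hl1)
    have := (abs_le.1 this).2; nlinarith
  have e2' : 0 ≤ Real.exp l - 1 := by
    have := Real.one_le_exp hl; linarith
  rw [div_le_iff₀ hk]
  have a1 := mul_le_mul_of_nonpos_right h1 e1'
  have a2 := mul_le_mul_of_nonneg_right h2 e2'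
  have a3 := mul_le_mul_of_nonneg_left e1 (mul_nonneg hα₁ hk.le)
  have a4 := mul_le_mul_of_nonneg_left e2 (mul_nonneg hα₂ hk.le)
  have a5 := Real.add_one_le_exp (-(α₁ - α₂) * l + (α₁ + α₂) * l^2)
  have a6 := mul_le_mul_of_nonneg_right a5 hk.le
  refine le_trans ?_ a6
  change k + _ + _ ≤ _
  nlinarith
lemma mode_bound (N k : ℕ) (hk : 0 < k) (hkN : k < N) :
    (N:ℝ)^N ≤ (N+1) * ((N.choose k : ℝ) * (k:ℝ)^k * ((N-k : ℕ):ℝ)^(N-k)) := by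
  set a : ℕ → ℕ := fun j => N.choose j * k^j * (N-k)^(N-j) with ha
  have hstep : ∀ j, j < N → a j * ((N-j) * k) = a (j+1) * ((j+1) * (N-k)) := by
    intro j hj
    simp only [ha]
    have h1 := Nat.choose_succ_right_eq N j
    have h2 : N - j = (N - (j+1)) + 1 := by omega
    calc N.choose j * k^j * (N-k)^(N-j) * ((N-j) * k) = (N.choose j * (N-j)) * k^(j+1) * (N-k)^(N-j) := by ring
      _ = (N.choose (j+1) * (j+1)) * k^(j+1) * (N-k)^((N - (j+1)) + 1) := by rw [h1, ← h2]
      _ = _ := by ring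
  have hup : ∀ j, j < k → a j ≤ a (j+1) := by
    intro j hj
    have h := hstep j (by omega)
    have h1 : (j+1) * (N-k) ≤ (N-j) * k := by
      rw [mul_comm (N-j)]; exact Nat.mul_le_mul (by omega) (by omega)
    have h2 : 0 < (N-j) * k := Nat.mul_pos (by omega) hk
    refine Nat.le_of_mul_le_mul_right ?_ h2
    rw [h]; exact Nat.mul_le_mul_left _ h1
  have hdn : ∀ j, k ≤ j → j < N → a (j+1) ≤ a j := by
    intro j hj hjN
    have h := hstep j hjN
    have h1 : (N-j) * k ≤ (j+1) * (N-k) := by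
      rw [mul_comm (N-j)]; exact Nat.mul_le_mul (by omega) (by omega)
    have h2 : 0 < (j+1) * (N-k) := Nat.mul_pos (by omega) (by omega)
    refine Nat.le_of_mul_le_mul_right ?_ h2
    rw [← h]; exact Nat.mul_le_mul_left _ h1
  have hlow : ∀ d, d ≤ k → a (k - d) ≤ a k := by
    intro d
    induction d with
    | zero => simp
    | succ d ih =>
      intro hd
      have := hup (k - (d+1)) (by omega)
      rw [show k - (d+1) + 1 = k - d by omega] at this
      exact this.trans (ih (by omega))
  have hhigh : ∀ d, k + d ≤ N → a (k + d) ≤ a k := by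
    intro d
    induction d with
    | zero => simp
    | succ d ih =>
      intro hd
      exact (hdn (k+d) (by omega) (by omega)).trans (ih (by omega))
  have hall : ∀ j, j ≤ N → a j ≤ a k := by
    intro j hj
    rcases le_total j k with h | h
    · have := hlow (k - j) (by omega)
      rwa [show k - (k-j) = j by omega] at this
    · have := hhigh (j - k) (by omega)
      rwa [show k + (j-k) = j by omega] at this
  have hsum : N^N = ∑ j ∈ Finset.range (N+1), a j := by
    have := add_pow k (N-k) N
    rw [show k + (N-k) = N by omega] at this
    rw [this]
    refine Finset.sum_congr rfl fun j _ => ?_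
    simp only [ha]; push_cast; ring
  have : N^N ≤ (N+1) * a k := by
    rw [hsum]
    have := Finset.sum_le_card_nsmul (Finset.range (N+1)) a (a k) (fun j hj => hall j (by simp at hj; omega))
    simpa using this
  simp only [ha] at this
  exact_mod_cast this

lemma pow_le_exp_aux (x : ℝ) (hx : 0 ≤ x) (k : ℕ) : x^k ≤ Real.exp (k * (x - 1)) := by
  rw [Real.exp_nat_mul]
  have := Real.add_one_le_exp (x - 1)
  exact pow_le_pow_left₀ hx (by linarith) k

lemma choose_lower (N k : ℕ) (hk : 0 < k) (hkN : k < N) (ε : ℝ) (h0 : 0 < ε) (h1 : ε < 1)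
    (hw : ((k:ℝ) - N * ε)^2 ≤ N * ε * (1-ε)) :
    1 ≤ (N+1) * Real.exp 1 * ((N.choose k : ℝ) * ε^k * (1-ε)^(N-k)) := by
  have hm := mode_bound N k hk hkN
  have h1' : 0 < 1 - ε := by linarith
  have hN : (0:ℝ) < N := by exact_mod_cast (by omega)
  have hc : ((N-k : ℕ):ℝ) = N - k := by rw [Nat.cast_sub hkN.le]
  have e1 := pow_le_exp_aux (k / (N * ε)) (by positivity) k
  have e2 := pow_le_exp_aux (((N-k : ℕ):ℝ) / (N * (1-ε))) (by positivity) (N-k)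
  have e3 : ((k:ℝ) / (N * ε))^k * (((N-k : ℕ):ℝ) / (N * (1-ε)))^(N-k) ≤ Real.exp 1 := by
    refine (mul_le_mul e1 e2 (by positivity) (Real.exp_pos _).le).trans ?_
    rw [← Real.exp_add]
    apply Real.exp_le_exp.2
    have : (k:ℝ) * (k / (N * ε) - 1) + ((N-k : ℕ):ℝ) * (((N-k : ℕ):ℝ) / (N * (1-ε)) - 1) = ((k:ℝ) - N * ε)^2 / (N * ε * (1-ε)) := by
      rw [hc]; field_simp; ring
    rw [this]
    exact (div_le_one (by positivity)).2 hw
  have e4 : ((k:ℝ) / (N * ε))^k * (((N-k : ℕ):ℝ) / (N * (1-ε)))^(N-k) = ((k:ℝ)^k * ((N-k : ℕ):ℝ)^(N-k)) / ((N:ℝ)^N * (ε^k * (1-ε)^(N-k))) := by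
    rw [div_pow, div_pow, mul_pow, mul_pow]
    have : (N:ℝ)^N = (N:ℝ)^k * (N:ℝ)^(N-k) := by rw [← pow_add]; congr 1; omega
    rw [this]; field_simp
  rw [e4, div_le_iff₀ (by positivity)] at e3
  have hNN : (0:ℝ) < (N:ℝ)^N := by positivity
  have hC : (0:ℝ) ≤ (N+1) * (N.choose k : ℝ) := by positivity
  have := mul_le_mul_of_nonneg_left e3 hC
  refine le_of_mul_le_mul_left ?_ hNN
  calc (N:ℝ)^N * 1 ≤ (N+1) * ((N.choose k : ℝ) * (k:ℝ)^k * ((N-k : ℕ):ℝ)^(N-k)) := by rw [mul_one]; exact hm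
    _ = (N+1) * (N.choose k : ℝ) * ((k:ℝ)^k * ((N-k : ℕ):ℝ)^(N-k)) := by ring
    _ ≤ _ := this
    _ = _ := by ring

lemma wt_eq (ε : ℝ) {n : ℕ} (x : Fin n → Bool) : wt ε x = ε^(numOnes x) * (1-ε)^(n - numOnes x) := by
  unfold wt numOnes
  rw [Finset.prod_ite, Finset.prod_const, Finset.prod_const, Finset.filter_not, Finset.card_sdiff_of_subset (Finset.filter_subset _ _)]
  simp

lemma numOnes_le {n : ℕ} (x : Fin n → Bool) : numOnes x ≤ n := by
  unfold numOnes; refine (Finset.card_le_univ _).trans ?_; simp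

lemma wt_sum (ε : ℝ) (n : ℕ) : ∑ x : Fin n → Bool, wt ε x = 1 := by
  unfold wt
  have := Finset.prod_univ_sum (fun _ : Fin n => (Finset.univ : Finset Bool)) (fun _ b => if b = true then ε else 1 - ε)
  rw [Fintype.piFinset_univ] at this
  rw [← this]; simp

lemma wt_pair (ε : ℝ) {n : ℕ} (s : State n) : wt ε s.1 * wt ε s.2 = ε^((onesSet s).card) * (1-ε)^(2*n - (onesSet s).card) := by
  rw [onesSet_card, N1, wt_eq, wt_eq]
  have h1 := numOnes_le s.1
  have h2 := numOnes_le s.2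
  rw [show 2 * n - (numOnes s.1 + numOnes s.2) = (n - numOnes s.1) + (n - numOnes s.2) by omega, pow_add, pow_add]
  ring

lemma bad_count (ε : ℝ) (h0 : 0 < ε) (h1 : ε < 1) (n k : ℕ) (E : (Fin n → Bool) → (Fin n → Bool) → Prop) :
    ((Finset.univ.filter fun s : State n => ¬ E s.1 s.2 ∧ (onesSet s).card = k).card : ℝ) * (ε^k * (1-ε)^(2*n-k)) ≤ 1 - pr ε n E := by
  have h1' : 0 < 1 - ε := by linarith
  have hp : pr ε n E = ∑ s : State n, if E s.1 s.2 then wt ε s.1 * wt ε s.2 else 0 := by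
    unfold pr; rw [Fintype.sum_prod_type]
  have hone : (1:ℝ) = ∑ s : State n, wt ε s.1 * wt ε s.2 := by
    rw [Fintype.sum_prod_type]; simp_rw [← Finset.mul_sum, wt_sum, mul_one]; exact (wt_sum ε n).symm
  rw [hp]
  conv_rhs => rw [hone]
  rw [← Finset.sum_sub_distrib, ← nsmul_eq_mul, ← Finset.sum_const, Finset.sum_filter]
  refine Finset.sum_le_sum fun s _ => ?_
  rw [wt_pair]
  have : 0 ≤ ε^((onesSet s).card) * (1-ε)^(2*n - (onesSet s).card) := by positivity
  by_cases hE : E s.1 s.2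
  · simp [hE]
  · simp only [hE, not_false_eq_true, true_and, if_false, sub_zero]
    split_ifs with hk
    · rw [hk]
    · exact this

lemma bad1_prob (ε : ℝ) (h0 : 0 < ε) (h1 : ε < 1) (n t : ℕ) (ht0 : 0 < t) (ht : t < 2*n)
    (E : (Fin n → Bool) → (Fin n → Bool) → Prop)
    (hw : (((2*n-t : ℕ):ℝ) - 2 * ε * n)^2 ≤ 2 * ε * (1-ε) * n) :
    trajProb n (fun p => ¬ (E (p ⟨t, by omega⟩).1 (p ⟨t, by omega⟩).2 ∧ (onesSet (p ⟨t, by omega⟩)).card ≠ 0))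
      ≤ (2*n+1) * Real.exp 1 * (1 - pr ε n E) := by
  have h1' : 0 < 1 - ε := by linarith
  unfold trajProb
  simp_rw [trajMass_eq]
  have := marginal (S := State n) stepMass (startMass n) stepMass_sum_one (fun s => ¬ (E s.1 s.2 ∧ (onesSet s).card ≠ 0)) (2*n) t ht
  set k := 2*n - t with hk
  have hb := bad_count ε h0 h1 n k E
  have hl := choose_lower (2*n) k (by omega) (by omega) ε h0 h1 (by push_cast; nlinarith)
  push_cast at hl
  have hC : ((2*n).choose t : ℝ) = ((2*n).choose k : ℝ) := by
    rw [hk, Nat.choose_symm ht.le]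
  have hCpos : (0:ℝ) < (2*n).choose k := by exact_mod_cast Nat.choose_pos (by omega)
  set Q : ℝ := ((Finset.univ.filter fun s : State n => ¬ E s.1 s.2 ∧ (onesSet s).card = k).card : ℝ) with hQ
  have hQ0 : 0 ≤ Q := by positivity
  have s1 : (∑ s : State n, if ¬ (E s.1 s.2 ∧ (onesSet s).card ≠ 0) then fwd (fun _ => stepMass) (startMass n) t s else 0) ≤ Q * (1 / ((2*n).choose k : ℝ)) := by
    rw [hQ, ← nsmul_eq_mul, ← Finset.sum_const, Finset.sum_filter]
    refine Finset.sum_le_sum fun s _ => ?_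
    have hu := fwd_uniform n t ht.le s
    rw [hC, ← hk] at hu
    by_cases hc : (onesSet s).card = k
    · rw [if_pos hc] at hu
      have : (onesSet s).card ≠ 0 := by omega
      by_cases hE : E s.1 s.2
      · rw [if_neg (fun h => h ⟨hE, this⟩), if_neg (fun h => h.1 hE)]
      · simp only [hE, hc, false_and, not_false_eq_true, if_true, and_self]; exact hu
    · rw [if_neg hc] at hu
      simp only [hc, and_false, if_false]
      split_ifs <;> first | exact hu | exact le_rfl
  refine (le_of_eq (Eq.trans ?_ (this.trans ?_))).trans (s1.trans ?_)
  · congr!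
  · congr!
  have hP : 0 < ε^k * (1-ε)^(2*n-k) := by positivity
  calc Q * (1 / ((2*n).choose k : ℝ)) ≤ Q * (1 / ((2*n).choose k : ℝ)) * ((2*n+1) * Real.exp 1 * (((2*n).choose k : ℝ) * ε^k * (1-ε)^(2*n-k))) :=
        le_mul_of_one_le_right (by positivity) hl
    _ = (2*n+1) * Real.exp 1 * (Q * (ε^k * (1-ε)^(2*n-k))) := by field_simp
    _ ≤ _ := mul_le_mul_of_nonneg_left hb (by positivity)

lemma prod_window (a b m : ℕ) (hb : b ≤ m) (f : ℕ → ℝ) :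
    ∏ k ∈ Finset.range m, (if a ≤ k ∧ k < b then f k else 1) = ∏ k ∈ Finset.Ico a b, f k := by
  rw [← Finset.prod_filter]
  congr 1
  ext k; simp; omega

lemma bad2_prob {n : ℕ} (a b : ℕ) (hab : a ≤ b) (hb : b ≤ 2*n) (G : State n → Prop) (l β ρ : ℝ) (hl : 0 ≤ l) (hρ : 0 ≤ ρ)
    (hG : ∀ s, G s → ∑ t, stepMass s t * Real.exp (-l * ((Lof t : ℝ) - Lof s)) ≤ ρ) :
    trajProb n (fun p => (∀ t (ht : t < b), a ≤ t → G (p ⟨t, by omega⟩)) ∧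
      (Lof (p ⟨b, by omega⟩) : ℝ) - Lof (p ⟨a, by omega⟩) < β * ((b:ℝ) - a)) ≤ (Real.exp (l * β) * ρ)^(b-a) := by
  set w : ℕ → State n → State n → ℝ := fun k s s' => if a ≤ k ∧ k < b then (if G s then Real.exp (-l * ((Lof s' : ℝ) - Lof s)) else 0) else 1 with hw
  have hw0 : ∀ k s s', 0 ≤ w k s s' := by
    intro k s s'; simp only [hw]; split_ifs <;> positivity
  set M : ℕ → State n → State n → ℝ := fun k s s' => stepMass s s' * w k s s' with hM
  have hbd := fwd_sum_le M (startMass n) (startMass_nonneg n) (fun k s s' => mul_nonneg (stepMass_nonneg _ _) (hw0 _ _ _))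
    (fun k => if a ≤ k ∧ k < b then ρ else 1) (fun k => by split_ifs <;> positivity) (by
      intro k s
      simp only [hM, hw]
      split_ifs with h1 h2
      · exact hG s h2
      · simpa using hρ
      · simp [stepMass_sum_one]) (2*n)
  rw [startMass_sum, one_mul, prod_window a b _ hb, Finset.prod_const, Nat.card_Ico, ← pathSum_fwd] at hbd
  rw [mul_pow]
  refine le_trans ?_ (mul_le_mul_of_nonneg_left hbd (by positivity))
  rw [Finset.mul_sum]
  unfold trajProb
  refine Finset.sum_le_sum fun p _ => ?_
  have hprod : startMass n (p 0) * ∏ j : Fin (2*n), M j (p j.castSucc) (p j.succ) = trajMass n p * ∏ j : Fin (2*n), w j (p j.castSucc) (p j.succ) := by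
    rw [trajMass_eq]; simp only [hM, Finset.prod_mul_distrib, mul_assoc]
  rw [hprod]
  have hT := trajMass_nonneg n p
  have hP0 : 0 ≤ ∏ j : Fin (2*n), w j (p j.castSucc) (p j.succ) := Finset.prod_nonneg fun _ _ => hw0 _ _ _
  split_ifs with hE
  · obtain ⟨hg, hlt⟩ := hE
    set q : ℕ → State n := fun t => p ⟨min t (2*n), by omega⟩ with hq
    have hqv : ∀ t (ht : t ≤ 2*n), q t = p ⟨t, by omega⟩ := by
      intro t ht; simp only [hq, min_eq_left ht]
    have e1 : ∏ j : Fin (2*n), w j (p j.castSucc) (p j.succ) = ∏ j ∈ Finset.range (2*n), w j (q j) (q (j+1)) := by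
      rw [← Fin.prod_univ_eq_prod_range (fun j => w j (q j) (q (j+1)))]
      refine Finset.prod_congr rfl fun j _ => ?_
      rw [hqv j (by omega), hqv (j+1) (by omega)]; rfl
    have e2 : ∏ j ∈ Finset.range (2*n), w j (q j) (q (j+1)) = ∏ j ∈ Finset.Ico a b, Real.exp (-l * ((Lof (q (j+1)) : ℝ) - Lof (q j))) := by
      simp only [hw]
      rw [prod_window a b _ hb (fun j => if G (q j) then Real.exp (-l * ((Lof (q (j+1)) : ℝ) - Lof (q j))) else 0)]
      refine Finset.prod_congr rfl fun j hj => ?_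
      rw [Finset.mem_Ico] at hj
      rw [if_pos]
      rw [hqv j (by omega)]; exact hg j hj.2 hj.1
    have e3 : ∏ j ∈ Finset.Ico a b, Real.exp (-l * ((Lof (q (j+1)) : ℝ) - Lof (q j))) = Real.exp (-l * ((Lof (q b) : ℝ) - Lof (q a))) := by
      rw [← Real.exp_sum, ← Finset.mul_sum, Finset.sum_Ico_sub (fun j => (Lof (q j) : ℝ)) hab]
    rw [e1, e2, e3, hqv a (by omega), hqv b hb, ← Real.exp_nat_mul, Nat.cast_sub hab]
    have : 1 ≤ Real.exp (((b:ℝ) - a) * (l * β)) * Real.exp (-l * ((Lof (p ⟨b, by omega⟩) : ℝ) - Lof (p ⟨a, by omega⟩))) := by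
      rw [← Real.exp_add]; apply Real.one_le_exp
      nlinarith
    nlinarith
  · exact mul_nonneg (by positivity) (mul_nonneg hT hP0)
lemma trajProb_compl (n : ℕ) (E) : trajProb n E = 1 - trajProb n (fun p => ¬ E p) := by
  rw [← trajMass_sum n, eq_sub_iff_add_eq]
  unfold trajProb
  rw [← Finset.sum_add_distrib]
  refine Finset.sum_congr rfl fun p _ => ?_
  by_cases h : E p <;> simp [h]

lemma trajProb_nonneg (n : ℕ) (E) : 0 ≤ trajProb n E :=
  Finset.sum_nonneg fun p _ => by split_ifs <;> first | exact trajMass_nonneg n p | exact le_rfl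

lemma trajProb_mono (n : ℕ) (E E' : (Fin (2 * n + 1) → State n) → Prop) (h : ∀ p, E p → E' p) : trajProb n E ≤ trajProb n E' := by
  unfold trajProb
  refine Finset.sum_le_sum fun p _ => ?_
  by_cases h1 : E p
  · simp [h1, h p h1]
  · rw [if_neg h1]; split_ifs <;> first | exact trajMass_nonneg n p | exact le_rfl

lemma trajProb_or (n : ℕ) (E E' : (Fin (2 * n + 1) → State n) → Prop) : trajProb n (fun p => E p ∨ E' p) ≤ trajProb n E + trajProb n E' := by
  unfold trajProb
  rw [← Finset.sum_add_distrib]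
  refine Finset.sum_le_sum fun p _ => ?_
  have := trajMass_nonneg n p
  by_cases h1 : E p <;> by_cases h2 : E' p <;> simp [h1, h2, this]

lemma trajProb_exists (n : ℕ) {ι : Type} (T : Finset ι) (A : ι → (Fin (2 * n + 1) → State n) → Prop) (c : ℝ) 
    (hA : ∀ i ∈ T, trajProb n (A i) ≤ c) :
    trajProb n (fun p => ∃ i ∈ T, A i p) ≤ T.card * c := by
  have : trajProb n (fun p => ∃ i ∈ T, A i p) ≤ ∑ i ∈ T, trajProb n (A i) := by
    unfold trajProb
    rw [Finset.sum_comm]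
    refine Finset.sum_le_sum fun p _ => ?_
    have h0 : ∀ i ∈ T, 0 ≤ if A i p then trajMass n p else 0 := fun i _ => by
      split_ifs <;> first | exact trajMass_nonneg n p | exact le_rfl
    split_ifs with h
    · obtain ⟨i, hi, hAi⟩ := h
      have := Finset.single_le_sum h0 hi
      rwa [if_pos hAi] at this
    · exact Finset.sum_nonneg h0
  refine this.trans ?_
  rw [← nsmul_eq_mul]
  exact Finset.sum_le_card_nsmul _ _ _ hA

lemma asymp (κ : ℝ) (hκ : 0 < κ) : ∃ N : ℕ, ∀ n : ℕ, N ≤ n →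
    (n:ℝ)^2 * 36 * Real.exp (-(2 * κ) * (n:ℝ)^(0.1:ℝ)) ≤ Real.exp (-κ * (n:ℝ)^(0.1:ℝ)) := by
  have h1 := tendsto_rpow_mul_exp_neg_mul_atTop_nhds_zero 20 κ hκ
  have h2 : Filter.Tendsto (fun n : ℕ => (n:ℝ)^(0.1:ℝ)) Filter.atTop Filter.atTop :=
    (tendsto_rpow_atTop (by norm_num)).comp tendsto_natCast_atTop_atTop
  have h3 := (h1.comp h2).eventually (gt_mem_nhds (show (0:ℝ) < 1/36 by norm_num))
  obtain ⟨N, hN⟩ := Filter.eventually_atTop.1 h3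
  refine ⟨N, fun n hn => ?_⟩
  have h4 := hN n hn
  simp only [Function.comp] at h4
  rw [← Real.rpow_mul (by positivity), show (0.1:ℝ) * 20 = (2:ℕ) by norm_num, Real.rpow_natCast] at h4
  have h5 : Real.exp (-(2 * κ) * (n:ℝ)^(0.1:ℝ)) = Real.exp (-κ * (n:ℝ)^(0.1:ℝ)) * Real.exp (-κ * (n:ℝ)^(0.1:ℝ)) := by
    rw [← Real.exp_add]; ring_nf
  rw [h5]
  have h6 := Real.exp_pos (-κ * (n:ℝ)^(0.1:ℝ))
  nlinarith

set_option maxHeartbeats 1000000 in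
/-- under the hypothesis of Theorem 2.2 (good sets B_n of probability ≥ 1 − e^{−c₁n}
on which n₊ ≥ α₁N₁ and n₋ ≤ α₂N₁), with α₃ = (α₁ − α₂)/2 and
I = [2εn − √(2ε(1−ε)n), 2εn + √(2ε(1−ε)n)], there exists c₄ > 0 such that for all large n,
with probability ≥ 1 − e^{−c₄ n^{0.1}}, for all integers i, j ∈ I with i + n^{0.1} ≤ j one has
L(i) − L(j) ≥ α₃(j − i), where L(k) is the LCS length of the chain state carrying k ones. -/
theorem stmt3 (ε : ℝ) (hε : 0 < ε) (hε' : ε ≤ 1 / 2)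
    (α₁ α₂ c₁ : ℝ) (hα₂ : 0 < α₂) (hα : α₂ < α₁) (hc₁ : 0 < c₁)
    (B : ∀ n : ℕ, (Fin n → Bool) → (Fin n → Bool) → Prop)
    (hB : ∀ n : ℕ, ∀ x y : Fin n → Bool, B n x y →
      α₁ * (N1 x y : ℝ) ≤ (nPlus x y : ℝ) ∧ (nMinus x y : ℝ) ≤ α₂ * (N1 x y : ℝ))
    (hBprob : ∀ n : ℕ, 1 - Real.exp (-c₁ * n) ≤ pr ε n (B n)) :
    ∃ c₄ : ℝ, 0 < c₄ ∧ ∃ N : ℕ, ∀ n : ℕ, N ≤ n →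
      1 - Real.exp (-c₄ * (n : ℝ) ^ (0.1 : ℝ)) ≤
        trajProb n (fun path =>
          ∀ i j : ℕ,
            2 * ε * n - Real.sqrt (2 * ε * (1 - ε) * n) ≤ (i : ℝ) →
            (i : ℝ) ≤ 2 * ε * n + Real.sqrt (2 * ε * (1 - ε) * n) →
            2 * ε * n - Real.sqrt (2 * ε * (1 - ε) * n) ≤ (j : ℝ) →
            (j : ℝ) ≤ 2 * ε * n + Real.sqrt (2 * ε * (1 - ε) * n) →
            (i : ℝ) + (n : ℝ) ^ (0.1 : ℝ) ≤ (j : ℝ) →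
            ((α₁ - α₂) / 2) * ((j : ℝ) - (i : ℝ)) ≤
              (Lof (path ⟨2 * n - i, by omega⟩) : ℝ) - (Lof (path ⟨2 * n - j, by omega⟩) : ℝ)) := by
  have hε1 : ε < 1 := by linarith
  set β := (α₁ - α₂) / 2 with hβ
  have hβ0 : 0 < β := by rw [hβ]; linarith
  have hα₁ : 0 < α₁ := by linarith
  set l := β / (2 * (α₁ + α₂)) with hl
  have hl0 : 0 < l := by rw [hl]; positivity
  have hl1 : l ≤ 1 := by
    rw [hl, div_le_one (by positivity)]; linarith
  have hll : (α₁ + α₂) * l = β / 2 := by rw [hl]; field_simp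
  set δ := β * l / 2 with hδ
  have hδ0 : 0 < δ := by positivity
  set κ := min δ c₁ / 2 with hκ
  have hκ0 : 0 < κ := by have := lt_min hδ0 hc₁; positivity
  obtain ⟨N, hN⟩ := asymp κ hκ0
  refine ⟨κ, hκ0, max N 1, fun n hn => ?_⟩
  have hasy := hN n (le_trans (le_max_left _ _) hn)
  have hn1 : 1 ≤ n := le_trans (le_max_right _ _) hn
  have hn1R : (1:ℝ) ≤ n := by exact_mod_cast hn1
  set W := Real.sqrt (2 * ε * (1 - ε) * n) with hW
  set X := (n:ℝ)^(0.1:ℝ) with hX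
  have hX1 : 1 ≤ X := Real.one_le_rpow hn1R (by norm_num)
  have hXn : X ≤ n := by
    have := Real.rpow_le_rpow_of_exponent_le hn1R (show (0.1:ℝ) ≤ 1 by norm_num)
    rwa [Real.rpow_one] at this
  have hW0 : 0 ≤ W := Real.sqrt_nonneg _
  have hW2 : W^2 = 2 * ε * (1 - ε) * n := Real.sq_sqrt (by
    have : 0 < 1 - ε := by linarith
    positivity)
  have hWn : W < n := by
    have h1 : 2 * ε * (1 - ε) ≤ 1/2 := by nlinarith [sq_nonneg (ε - 1/2)]
    have h2 : W^2 < (n:ℝ)^2 := by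
      rw [hW2]; nlinarith
    exact lt_of_pow_lt_pow_left₀ 2 (by positivity) h2
  rw [trajProb_compl]
  apply sub_le_sub_left
  -- the bad events
  set G : State n → Prop := fun s => B n s.1 s.2 ∧ (onesSet s).card ≠ 0 with hG
  set A : ℕ → (Fin (2 * n + 1) → State n) → Prop := fun t p =>
    ∃ h : t < 2 * n, 0 < t ∧ (((2*n-t : ℕ):ℝ) - 2 * ε * n)^2 ≤ 2 * ε * (1-ε) * n ∧ ¬ G (p ⟨t, by omega⟩) with hA
  set D : ℕ × ℕ → (Fin (2 * n + 1) → State n) → Prop := fun ab p =>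
    ∃ (_ : ab.1 ≤ ab.2) (h2 : ab.2 ≤ 2*n), X ≤ (ab.2 : ℝ) - ab.1 ∧
      (∀ t (ht : t < ab.2), ab.1 ≤ t → G (p ⟨t, by omega⟩)) ∧
      (Lof (p ⟨ab.2, by omega⟩) : ℝ) - Lof (p ⟨ab.1, by omega⟩) < β * ((ab.2:ℝ) - ab.1) with hD
  have hAp : ∀ t ∈ Finset.range (2*n), trajProb n (A t) ≤ (2*n+1) * Real.exp 1 * Real.exp (-c₁ * n) := by
    intro t _
    by_cases hc : ∃ h : t < 2 * n, 0 < t ∧ (((2*n-t : ℕ):ℝ) - 2 * ε * n)^2 ≤ 2 * ε * (1-ε) * n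
    · obtain ⟨h, h0, hw⟩ := hc
      have h1 := bad1_prob ε hε hε1 n t h0 h (B n) hw
      refine (trajProb_mono n _ _ ?_).trans (h1.trans ?_)
      · rintro p ⟨_, _, _, hg⟩; exact hg
      · have := hBprob n
        apply mul_le_mul_of_nonneg_left _ (by positivity)
        linarith
    · refine (trajProb_mono n _ (fun _ => False) ?_).trans ?_
      · rintro p ⟨h, h0, hw, _⟩; exact hc ⟨h, h0, hw⟩
      · simp only [trajProb, if_false, Finset.sum_const_zero]; positivity
  have hDp : ∀ ab ∈ (Finset.range (2*n+1) ×ˢ Finset.range (2*n+1)), trajProb n (D ab) ≤ Real.exp (-δ * X) := by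
    rintro ⟨a, b⟩ _
    by_cases hc : a ≤ b ∧ b ≤ 2*n ∧ X ≤ (b:ℝ) - a
    · obtain ⟨h1, h2, h3⟩ := hc
      have := bad2_prob a b h1 h2 G l β (Real.exp (-(α₁ - α₂) * l + (α₁ + α₂) * l^2)) hl0.le (Real.exp_pos _).le (by
        rintro s ⟨hs1, hs2⟩
        have := hB n s.1 s.2 hs1
        exact step_exp s α₁ α₂ l hl0.le hl1 hα₁.le hα₂.le this.1 this.2 hs2)
      refine (trajProb_mono n _ _ ?_).trans (this.trans ?_)
      · rintro p ⟨_, _, _, hg⟩; exact hg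
      · rw [← Real.exp_add, ← Real.exp_nat_mul, Nat.cast_sub h1]
        apply Real.exp_le_exp.2
        have e : l * β + (-(α₁ - α₂) * l + (α₁ + α₂) * l^2) = -δ := by
          have : α₁ - α₂ = 2 * β := by rw [hβ]; ring
          rw [this, hδ, show (α₁ + α₂) * l^2 = ((α₁ + α₂) * l) * l by ring, hll]; ring
        rw [e]; nlinarith
    · refine (trajProb_mono n _ (fun _ => False) ?_).trans ?_
      · rintro p ⟨h, h0, hw, _⟩; exact hc ⟨h, h0, hw⟩
      · simp only [trajProb, if_false, Finset.sum_const_zero]; positivity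
  have hA' := trajProb_exists n _ A _ hAp
  have hD' := trajProb_exists n _ D _ hDp
  refine (trajProb_mono n _ (fun p => (∃ t ∈ Finset.range (2*n), A t p) ∨ 
    (∃ ab ∈ (Finset.range (2*n+1) ×ˢ Finset.range (2*n+1)), D ab p)) ?_).trans 
    ((trajProb_or n _ _).trans ((add_le_add hA' hD').trans ?_))
  · intro p hp
    by_contra hcon
    apply hp
    rw [not_or] at hcon
    obtain ⟨hc1, hc2⟩ := hcon
    intro i j hi1 hi2 hj1 hj2 hij
    have hεn : 2 * ε * n ≤ n := by nlinarith
    have hj2n : j < 2 * n := by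
      have : (j:ℝ) < 2 * n := by linarith
      exact_mod_cast this
    have hijN : i < j := by
      have : (i:ℝ) < j := by linarith
      exact_mod_cast this
    by_contra hlt
    apply hc2
    refine ⟨(2*n-j, 2*n-i), by simp, by simp; omega, by simp, ?_, ?_, ?_⟩
    · simp only
      rw [Nat.cast_sub (by omega), Nat.cast_sub (by omega)]; linarith
    · intro t ht hat
      simp only at ht hat
      by_contra hg
      apply hc1
      refine ⟨t, by simp; omega, by omega, by omega, ?_, hg⟩
      have k1 : (i:ℝ) ≤ ((2*n-t:ℕ):ℝ) := by exact_mod_cast (by omega)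
      have k2 : ((2*n-t:ℕ):ℝ) ≤ (j:ℝ) := by exact_mod_cast (by omega)
      rw [← hW2]
      apply sq_le_sq'
      · linarith
      · linarith
    · simp only
      rw [Nat.cast_sub (by omega), Nat.cast_sub (by omega)]
      have := lt_of_not_ge hlt
      push_cast
      linarith
  · refine le_trans ?_ hasy
    rw [Finset.card_product, Finset.card_range, Finset.card_range]
    push_cast
    have k1 : Real.exp (-c₁ * n) ≤ Real.exp (-(2*κ) * X) := by
      apply Real.exp_le_exp.2
      have : 2 * κ ≤ c₁ := by rw [hκ]; have := min_le_right δ c₁; linarith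
      have := mul_le_mul this hXn (by linarith) hc₁.le
      linarith
    have k2 : Real.exp (-δ * X) ≤ Real.exp (-(2*κ) * X) := by
      apply Real.exp_le_exp.2
      have : 2 * κ ≤ δ := by rw [hκ]; have := min_le_left δ c₁; linarith
      have := mul_le_mul_of_nonneg_right this (show 0 ≤ X by linarith)
      linarith
    have k3 : Real.exp 1 ≤ 3 := Real.exp_one_lt_three.le
    set Z := Real.exp (-(2*κ) * X)
    have hZ : 0 < Z := Real.exp_pos _
    calc 2 * (n:ℝ) * ((2*n+1) * Real.exp 1 * Real.exp (-c₁ * n)) + (2*n+1) * (2*n+1) * Real.exp (-δ * X)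
        ≤ 2 * (n:ℝ) * ((2*n+1) * 3 * Z) + (2*n+1) * (2*n+1) * Z := by gcongr
      _ = (2 * (n:ℝ) * ((2*n+1) * 3) + (2*n+1) * (2*n+1)) * Z := by ring
      _ ≤ _ := by
        apply mul_le_mul_of_nonneg_right _ hZ.le
        nlinarith
end
end

section
/- There exists ε₃ > 0 such that for every ε ∈ (0, ε₃) there is a constant a(ε) > 0 with: for all n, P( L_n ≥ ((1 − ε) + 0.9·ε²)·n ) ≥ 1 − 5·e^{−a(ε)·n}. -/
open scoped BigOperators
open Classical

noncomputable section

/-- Greedy matching of two boolean lists: drop a `1` whenever the heads differ. -/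
def greedy : List Bool → List Bool → ℕ
  | [], _ => 0
  | _ :: _, [] => 0
  | true :: x, true :: y => greedy x y + 1
  | false :: x, false :: y => greedy x y + 1
  | true :: x, false :: y => greedy x (false :: y)
  | false :: x, true :: y => greedy (false :: x) y
  termination_by x y => x.length + y.length

lemma greedy_sub (x y : List Bool) :
    ∃ z : List Bool, z.length = greedy x y ∧ z.Sublist x ∧ z.Sublist y := by
  induction x, y using greedy.induct with
  | case1 y => exact ⟨[], by simp [greedy], by simp, by simp⟩
  | case2 a x => exact ⟨[], by simp [greedy], by simp, by simp⟩
  | case3 x y ih =>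
    obtain ⟨z, h, hx, hy⟩ := ih
    exact ⟨true :: z, by simp [greedy, h], hx.cons_cons _, hy.cons_cons _⟩
  | case4 x y ih =>
    obtain ⟨z, h, hx, hy⟩ := ih
    exact ⟨false :: z, by simp [greedy, h], hx.cons_cons _, hy.cons_cons _⟩
  | case5 x y ih =>
    obtain ⟨z, h, hx, hy⟩ := ih
    exact ⟨z, by rw [h, greedy], hx.cons _, hy⟩
  | case6 x y ih =>
    obtain ⟨z, h, hx, hy⟩ := ih
    exact ⟨z, by rw [h, greedy], hx, hy.cons _⟩

lemma greedy_le (x y : List Bool) : greedy x y ≤ lcsLen x y := by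
  apply le_csSup
  · refine ⟨x.length, ?_⟩
    rintro k ⟨z, rfl, hx, _⟩
    exact hx.length_le
  · exact greedy_sub x y

/-- Expectation over a random list of length `n`, defined recursively. -/
def Ex (ε : ℝ) : ℕ → (List Bool → ℝ) → ℝ
  | 0, f => f []
  | n + 1, f => ε * Ex ε n (fun x => f (true :: x)) + (1 - ε) * Ex ε n (fun x => f (false :: x))

lemma Ex_lin (ε : ℝ) (n : ℕ) (a b : ℝ) (f g : List Bool → ℝ) :
    Ex ε n (fun x => a * f x + b * g x) = a * Ex ε n f + b * Ex ε n g := by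
  induction n generalizing f g with
  | zero => rfl
  | succ n ih => simp only [Ex, ih]; ring

lemma Ex_mul (ε : ℝ) (n : ℕ) (a : ℝ) (f : List Bool → ℝ) :
    Ex ε n (fun x => a * f x) = a * Ex ε n f := by
  have := Ex_lin ε n a 0 f f
  simpa using this

lemma Ex_const (ε : ℝ) (n : ℕ) (a : ℝ) : Ex ε n (fun _ => a) = a := by
  induction n with
  | zero => rfl
  | succ n ih => simp only [Ex, ih]; ring

lemma sum_wt (ε : ℝ) (n : ℕ) (f : List Bool → ℝ) :
    ∑ x : Fin n → Bool, wt ε x * f (List.ofFn x) = Ex ε n f := by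
  induction n generalizing f with
  | zero => simp [wt, Ex]
  | succ n ih =>
    rw [← (Fin.consEquiv (fun _ : Fin (n + 1) => Bool)).sum_comp, Fintype.sum_prod_type]
    simp only [Fintype.sum_bool, Ex, ← ih, Finset.mul_sum]
    congr 1 <;>
    · apply Finset.sum_congr rfl
      intro x _
      simp [wt, Fin.prod_univ_succ, Fin.consEquiv, List.ofFn_succ, mul_assoc]

/-- Moment generating function bound for the greedy matching. -/
lemma mgf_bound (ε s u a : ℝ) (h0 : 0 < ε) (h1 : ε < 1) (hs : 0 < s) (hu : 0 < u) (ha : 1 ≤ a)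
    (hau : (1 - ε) * s + ε * a ≤ a * u)
    (hF : (ε ^ 2 + (1 - ε) ^ 2) * s + ε * (1 - ε) * (a + s) ≤ u) (k : ℕ) :
    ∀ m n : ℕ, m + n ≤ k →
      (Ex ε m (fun x => Ex ε n (fun y => s ^ greedy x y)) ≤ u ^ m + u ^ n) ∧
      (Ex ε m (fun x => Ex ε n (fun y => s ^ greedy x (false :: y))) ≤ a * u ^ m + s * u ^ n) ∧
      (Ex ε m (fun x => Ex ε n (fun y => s ^ greedy (false :: x) y)) ≤ s * u ^ m + a * u ^ n) := by
  have h1' : 0 < 1 - ε := by linarith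
  induction k with
  | zero =>
    intro m n h
    obtain ⟨rfl, rfl⟩ : m = 0 ∧ n = 0 := by omega
    simp [Ex, greedy]
    exact ⟨by linarith, by linarith⟩
  | succ k ih =>
    intro m n hmn
    have um : 0 < u ^ m := by positivity
    have un : 0 < u ^ n := by positivity
    refine ⟨?_, ?_, ?_⟩
    · rcases m with _ | m
      · simp [Ex, greedy, Ex_const]; positivity
      rcases n with _ | n
      · have : Ex ε (m + 1) (fun x => Ex ε 0 (fun y => s ^ greedy x y)) = 1 := by
          simp [Ex, greedy, Ex_const]
        rw [this]; simp; positivity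
      obtain ⟨hf, hg, hh⟩ := ih m n (by omega)
      have e : Ex ε (m + 1) (fun x => Ex ε (n + 1) (fun y => s ^ greedy x y)) =
        (ε ^ 2 + (1 - ε) ^ 2) * s * Ex ε m (fun x => Ex ε n (fun y => s ^ greedy x y)) +
        ε * (1 - ε) * (Ex ε m (fun x => Ex ε n (fun y => s ^ greedy x (false :: y))) +
          Ex ε m (fun x => Ex ε n (fun y => s ^ greedy (false :: x) y))) := by
        simp only [Ex, greedy, pow_succ', Ex_mul, Ex_lin]
        ring
      rw [e]
      have um : 0 < u ^ m := by positivity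
      have un : 0 < u ^ n := by positivity
      calc _ ≤ (ε ^ 2 + (1 - ε) ^ 2) * s * (u ^ m + u ^ n) +
            ε * (1 - ε) * ((a * u ^ m + s * u ^ n) + (s * u ^ m + a * u ^ n)) := by gcongr
        _ = ((ε ^ 2 + (1 - ε) ^ 2) * s + ε * (1 - ε) * (a + s)) * (u ^ m + u ^ n) := by ring
        _ ≤ u * (u ^ m + u ^ n) := by gcongr
        _ = _ := by ring
    · rcases m with _ | m
      · simp [Ex, greedy, Ex_const]
        have : 0 < s * u ^ n := by positivity
        linarith
      obtain ⟨hf, hg, hh⟩ := ih m n (by omega)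
      have e : Ex ε (m + 1) (fun x => Ex ε n (fun y => s ^ greedy x (false :: y))) =
        (1 - ε) * s * Ex ε m (fun x => Ex ε n (fun y => s ^ greedy x y)) +
        ε * Ex ε m (fun x => Ex ε n (fun y => s ^ greedy x (false :: y))) := by
        simp only [Ex, greedy, pow_succ', Ex_mul]
        ring
      rw [e]
      have um : 0 < u ^ m := by positivity
      calc _ ≤ (1 - ε) * s * (u ^ m + u ^ n) + ε * (a * u ^ m + s * u ^ n) := by gcongr
        _ = ((1 - ε) * s + ε * a) * u ^ m + s * u ^ n := by ring
        _ ≤ (a * u) * u ^ m + s * u ^ n := by gcongr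
        _ = _ := by ring
    · rcases n with _ | n
      · have : Ex ε m (fun x => Ex ε 0 (fun y => s ^ greedy (false :: x) y)) = 1 := by
          simp [Ex, greedy, Ex_const]
        rw [this]; simp
        have : 0 < s * u ^ m := by positivity
        linarith
      obtain ⟨hf, hg, hh⟩ := ih m n (by omega)
      have e : Ex ε m (fun x => Ex ε (n + 1) (fun y => s ^ greedy (false :: x) y)) =
        (1 - ε) * s * Ex ε m (fun x => Ex ε n (fun y => s ^ greedy x y)) +
        ε * Ex ε m (fun x => Ex ε n (fun y => s ^ greedy (false :: x) y)) := by
        simp only [Ex, greedy, pow_succ', Ex_mul, Ex_lin]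
        ring
      rw [e]
      have un : 0 < u ^ n := by positivity
      calc _ ≤ (1 - ε) * s * (u ^ m + u ^ n) + ε * (s * u ^ m + a * u ^ n) := by gcongr
        _ = ((1 - ε) * s + ε * a) * u ^ n + s * u ^ m := by ring
        _ ≤ (a * u) * u ^ n + s * u ^ m := by gcongr
        _ = _ := by ring

lemma wt_nonneg (ε : ℝ) (h0 : 0 < ε) (h1 : ε < 1) {n : ℕ} (x : Fin n → Bool) : 0 ≤ wt ε x := by
  apply Finset.prod_nonneg
  intro i _
  split_ifs <;> linarith

lemma chernoff (ε t θ : ℝ) (h0 : 0 < ε) (h1 : ε < 1) (ht : 0 < t) (n : ℕ) :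
    1 - Real.exp (t * θ * n) *
      Ex ε n (fun x => Ex ε n (fun y => (Real.exp (-t)) ^ greedy x y)) ≤
      pr ε n (fun x y => θ * n ≤ (Lcs x y : ℝ)) := by
  have e : 1 - Real.exp (t * θ * n) *
      Ex ε n (fun x => Ex ε n (fun y => (Real.exp (-t)) ^ greedy x y)) =
      ∑ x : Fin n → Bool, ∑ y : Fin n → Bool, wt ε x * (wt ε y *
        (1 * 1 + (-Real.exp (t * θ * n)) *
          (Real.exp (-t)) ^ greedy (List.ofFn x) (List.ofFn y))) := by
    simp only [← Finset.mul_sum]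
    have : ∀ x : Fin n → Bool, ∑ y : Fin n → Bool, wt ε y *
        (1 * 1 + (-Real.exp (t * θ * n)) *
          (Real.exp (-t)) ^ greedy (List.ofFn x) (List.ofFn y)) =
        1 * 1 + (-Real.exp (t * θ * n)) *
          Ex ε n (fun y => (Real.exp (-t)) ^ greedy (List.ofFn x) y) := by
      intro x
      rw [sum_wt ε n (fun y => 1 * 1 + (-Real.exp (t * θ * n)) *
          (Real.exp (-t)) ^ greedy (List.ofFn x) y), Ex_lin, Ex_const]
    simp only [this]
    rw [sum_wt ε n (fun x => 1 * 1 + (-Real.exp (t * θ * n)) *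
          Ex ε n (fun y => (Real.exp (-t)) ^ greedy x y)), Ex_lin, Ex_const]
    ring
  rw [e, pr]
  apply Finset.sum_le_sum
  intro x _
  apply Finset.sum_le_sum
  intro y _
  have hw : 0 ≤ wt ε x * wt ε y := mul_nonneg (wt_nonneg ε h0 h1 x) (wt_nonneg ε h0 h1 y)
  rw [← mul_assoc]
  split_ifs with h
  · apply mul_le_of_le_one_right hw
    have : 0 < Real.exp (t * θ * n) *
          (Real.exp (-t)) ^ greedy (List.ofFn x) (List.ofFn y) := by positivity
    linarith
  · apply mul_nonpos_of_nonneg_of_nonpos hw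
    have hg : (greedy (List.ofFn x) (List.ofFn y) : ℝ) ≤ (Lcs x y : ℝ) := by
      exact_mod_cast greedy_le _ _
    have : 1 ≤ Real.exp (t * θ * n) *
          (Real.exp (-t)) ^ greedy (List.ofFn x) (List.ofFn y) := by
      rw [← Real.exp_nat_mul, ← Real.exp_add]
      apply Real.one_le_exp
      push Not at h
      nlinarith
    linarith

/-- There exists ε₃ > 0 such that for every ε ∈ (0, ε₃) there is a constant a(ε) > 0 with:
for all n, P( L_n ≥ ((1 − ε) + 0.9·ε²)·n ) ≥ 1 − 5·e^{−a(ε)·n}. -/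
theorem stmt5 :
    ∃ ε₃ : ℝ, 0 < ε₃ ∧ ε₃ ≤ 1 / 2 ∧
      ∀ ε : ℝ, 0 < ε → ε < ε₃ →
        ∃ a : ℝ, 0 < a ∧ ∀ n : ℕ,
          1 - 5 * Real.exp (-a * n) ≤
            pr ε n (fun x y => ((1 - ε) + 0.9 * ε ^ 2) * n ≤ (Lcs x y : ℝ)) := by
  refine ⟨1 / 100, by norm_num, by norm_num, ?_⟩
  intro ε h0 h1
  set θ : ℝ := (1 - ε) + 0.9 * ε ^ 2 with hθ
  set r : ℝ := (1 - ε) + 0.95 * ε ^ 2 with hr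
  set t : ℝ := 0.01 * ε ^ 2 with htd
  have hε2 : 0 < ε ^ 2 := by positivity
  have hε2' : ε ^ 2 < 1 / 10000 := by nlinarith
  have ht : 0 < t := by positivity
  have hθ0 : 0 < θ := by linarith
  have hθ1 : θ < 1 := by nlinarith
  have hr0 : 0 < r := by linarith
  have hr1 : r < 1 := by nlinarith
  have hgap : θ * (1 + t) < r := by nlinarith
  set τ : ℝ := 1 - Real.exp (-t) with hτ
  have hτ0 : 0 < τ := by
    have : Real.exp (-t) < 1 := by rw [Real.exp_lt_one_iff]; linarith
    linarith
  have hτ2 : τ ≤ 1 / 2 := by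
    have := Real.add_one_le_exp (-t)
    linarith
  have hτ1 : t / (1 + t) ≤ τ := by
    have h := Real.add_one_le_exp t
    have h2 : Real.exp (-t) ≤ (1 + t)⁻¹ := by
      rw [Real.exp_neg]
      apply inv_anti₀ <;> linarith
    have h3 : t / (1 + t) = 1 - (1 + t)⁻¹ := by field_simp; ring
    linarith
  have hs : Real.exp (-t) = 1 - τ := by rw [hτ]; ring
  set u : ℝ := 1 - r * τ with hu
  have hrτ : r * τ ≤ 1 / 2 := by nlinarith
  have huε : 0 < u - ε := by linarith
  set a : ℝ := (1 - ε) * (1 - τ) / (u - ε) with had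
  have hmul : a * (u - ε) = (1 - ε) * (1 - τ) := by rw [had]; field_simp
  have hmgf := fun n => (mgf_bound ε (Real.exp (-t)) u a h0 (by linarith) (Real.exp_pos _)
    (by linarith)
    (by rw [had, le_div_iff₀ huε]; nlinarith)
    (by rw [hs]; linarith)
    (by
      rw [hs]
      refine le_of_mul_le_mul_right ?_ huε
      have e1 : ((ε ^ 2 + (1 - ε) ^ 2) * (1 - τ) + ε * (1 - ε) * (a + (1 - τ))) * (u - ε) =
        (1 - τ) * ((ε ^ 2 + (1 - ε) ^ 2 + ε * (1 - ε)) * (u - ε) + ε * (1 - ε) * (1 - ε)) := by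
        linear_combination ε * (1 - ε) * hmul
      rw [e1]
      have e2 : u * (u - ε) -
        (1 - τ) * ((ε ^ 2 + (1 - ε) ^ 2 + ε * (1 - ε)) * (u - ε) + ε * (1 - ε) * (1 - ε)) =
        τ * ε ^ 2 * ((1 - ε) * (0.05 - 0.95 * ε) - τ * r * 0.05) := by
        rw [hu, hr]; ring
      have e3 : 0 ≤ (1 - ε) * (0.05 - 0.95 * ε) - τ * r * 0.05 := by nlinarith
      have e4 : 0 ≤ τ * ε ^ 2 * ((1 - ε) * (0.05 - 0.95 * ε) - τ * r * 0.05) := by positivity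
      linarith)
    (n + n) n n le_rfl).1
  refine ⟨t * (r / (1 + t) - θ), ?_, ?_⟩
  · apply mul_pos ht
    rw [sub_pos, lt_div_iff₀ (by linarith)]
    exact hgap
  · intro n
    refine le_trans ?_ (chernoff ε t θ h0 (by linarith) ht n)
    have hue : u ≤ Real.exp (-(t * (r / (1 + t)))) := by
      have h := Real.add_one_le_exp (-(t * (r / (1 + t))))
      have h3 : t * (r / (1 + t)) = r * (t / (1 + t)) := by ring
      have h4 : r * (t / (1 + t)) ≤ r * τ := by gcongr
      linarith
    have hun : u ^ n ≤ Real.exp (-(t * (r / (1 + t))) * n) := by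
      rw [mul_comm, Real.exp_nat_mul]
      exact pow_le_pow_left₀ (by linarith) hue n
    have hfin : Real.exp (t * θ * n) *
        Ex ε n (fun x => Ex ε n (fun y => (Real.exp (-t)) ^ greedy x y)) ≤
        2 * Real.exp (-(t * (r / (1 + t) - θ)) * n) := by
      calc _ ≤ Real.exp (t * θ * n) * (2 * Real.exp (-(t * (r / (1 + t))) * n)) := by
            gcongr
            linarith [hmgf n]
        _ = 2 * (Real.exp (t * θ * n) * Real.exp (-(t * (r / (1 + t))) * n)) := by ring
        _ = _ := by rw [← Real.exp_add]; congr 2; ring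
    have := Real.exp_pos (-(t * (r / (1 + t) - θ)) * n)
    linarith
end
end
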